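/- Fix 0 < q < 1 and an integer n ≥ 1. For 0 < α < q^{-1}, the little q-Laguerre/Wall polynomial L_n^{(α)}(·;q) has n distinct real zeros x_1(α) < ⋯ < x_n(α), and for each j ∈ {1,...,n} the zero x_j(α) is a strictly decreasing function of α on (0, q^{-1}). -/

import Mathlib

/-- q-Pochhammer symbol `(a;q)_k = ∏_{j=0}^{k-1} (1 - a q^j)`. -/
noncomputable def qpoch (q a : ℝ) (k : ℕ) : ℝ := ∏ j ∈ Finset.range k, (1 - a * q ^ j)

/-- Little q-Laguerre/Wall polynomial `L_n^{(α)}(x;q)`. -/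
noncomputable def littleQLaguerrePoly (q : ℝ) (n : ℕ) (α x : ℝ) : ℝ :=
  ∑ k ∈ Finset.range (n + 1),
    qpoch q (q ^ (-(n : ℤ))) k / (qpoch q (α * q) k * qpoch q q k) * (q * x) ^ k

open Filter Topology Finset

/-- The polynomial function with constant term `1` whose zeros are `x 1, …, x n`. -/
noncomputable def rootProd (n : ℕ) (x : ℕ → ℝ) (t : ℝ) : ℝ :=
  ∏ i ∈ range n, (1 - t / x (i + 1))

/-- `x 0 = 0` and `x 1, …, x n` are positive with consecutive ratios at least `q⁻¹`. -/
structure QSpaced (q : ℝ) (n : ℕ) (x : ℕ → ℝ) : Prop where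
  zero : x 0 = 0
  pos : ∀ i < n, 0 < x (i + 1)
  le : ∀ i < n, x i ≤ q * x (i + 1)

/-- `y 1, …, y n` are zeros of `f(t) - c f(q t)`, where `f = rootProd n x`, which interlace with
the zeros of `f(t)` and of `f(q t)`. -/
structure QInterlace (q : ℝ) (n : ℕ) (c : ℝ) (x y : ℕ → ℝ) : Prop where
  zero : y 0 = 0
  pos : ∀ i < n, 0 < y (i + 1)
  lower : ∀ i < n, x i ≤ q * y (i + 1)
  upper : ∀ i < n, y (i + 1) ≤ x (i + 1)
  root : ∀ i < n, rootProd n x (y (i + 1)) = c * rootProd n x (q * y (i + 1))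

lemma rootProd_zero (n : ℕ) (x : ℕ → ℝ) : rootProd n x 0 = 1 := by simp [rootProd]

lemma continuous_rootProd (n : ℕ) (x : ℕ → ℝ) : Continuous (rootProd n x) := by
  unfold rootProd
  fun_prop

namespace QSpaced

variable {q : ℝ} {n : ℕ} {x : ℕ → ℝ}

lemma nonneg (h : QSpaced q n x) {i : ℕ} (hi : i ≤ n) : 0 ≤ x i := by
  rcases i with _ | i
  · exact h.zero.ge
  · exact (h.pos i hi).le

lemma le_mul (h : QSpaced q n x) (hq1 : q < 1) {i j : ℕ} (hij : i < j)
    (hj : j ≤ n) : x i ≤ q * x j := by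
  induction j with
  | zero => omega
  | succ j ih =>
    rcases Nat.lt_succ_iff_lt_or_eq.1 hij with h' | rfl
    · have h1 := ih h' (by omega)
      have h2 := h.le j hj
      have h3 := h.nonneg (i := j) (by omega)
      nlinarith
    · exact h.le i hj

lemma lt (h : QSpaced q n x) (hq1 : q < 1) {i j : ℕ} (hij : i < j)
    (hj : j ≤ n) : x i < x j := by
  have h1 := h.le_mul hq1 hij hj
  obtain ⟨k, rfl⟩ : ∃ k, j = k + 1 := ⟨j - 1, by omega⟩
  have h2 := h.pos k hj
  nlinarith

lemma mono (h : QSpaced q n x) (hq1 : q < 1) {i j : ℕ} (hij : i ≤ j)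
    (hj : j ≤ n) : x i ≤ x j := by
  rcases hij.lt_or_eq with h' | rfl
  · exact (h.lt hq1 h' hj).le
  · exact le_rfl

lemma rootProd_self (h : QSpaced q n x) {i : ℕ} (hi : i < n) : rootProd n x (x (i + 1)) = 0 :=
  prod_eq_zero (mem_range.2 hi) (by rw [div_self (h.pos i hi).ne', sub_self])

lemma exists_of_rootProd_eq_zero (h : QSpaced q n x) {t : ℝ} (ht : rootProd n x t = 0) :
    ∃ i < n, t = x (i + 1) := by
  obtain ⟨i, hi, h0⟩ := prod_eq_zero_iff.1 ht
  have hi := mem_range.1 hi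
  refine ⟨i, hi, ?_⟩
  have := (h.pos i hi).ne'
  field_simp at h0
  linarith

lemma rootProd_ne_zero (h : QSpaced q n x) (hq1 : q < 1) {j : ℕ} (hj : j < n) {t : ℝ}
    (h1 : x j < t) (h2 : t < x (j + 1)) : rootProd n x t ≠ 0 := by
  intro h0
  obtain ⟨i, hi, rfl⟩ := h.exists_of_rootProd_eq_zero h0
  rcases lt_or_ge i j with hij | hij
  · exact absurd (h.mono hq1 (i := i + 1) (j := j) hij hj.le) (not_le.2 h1)
  · exact absurd (h.mono hq1 (i := j + 1) (j := i + 1) (by omega) hi) (not_le.2 h2)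

lemma rootProd_mul_nonneg (h : QSpaced q n x) (hq1 : q < 1) {j : ℕ} (hj : j < n) {s t : ℝ}
    (hs1 : x j ≤ s) (hs2 : s ≤ x (j + 1)) (ht1 : x j ≤ t) (ht2 : t ≤ x (j + 1)) :
    0 ≤ rootProd n x s * rootProd n x t := by
  rw [rootProd, rootProd, ← prod_mul_distrib]
  refine prod_nonneg fun i hi => ?_
  have hi := mem_range.1 hi
  have hp := h.pos i hi
  rcases lt_or_ge i j with hij | hij
  · have hm := h.mono hq1 (i := i + 1) (j := j) hij hj.le
    apply mul_nonneg_of_nonpos_of_nonpos <;> rw [sub_nonpos, one_le_div hp] <;> linarith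
  · have hm := h.mono hq1 (i := j + 1) (j := i + 1) (by omega) hi
    apply mul_nonneg <;> rw [sub_nonneg, div_le_one hp] <;> linarith

lemma exists_interlace (h : QSpaced q n x) (hq0 : 0 < q) (hq1 : q < 1) {c : ℝ} (hc0 : 0 < c)
    (hc1 : c < 1) : ∃ y, QInterlace q n c x y := by
  have key : ∀ j < n, ∃ y, 0 < y ∧ x j ≤ q * y ∧ y ≤ x (j + 1) ∧
      rootProd n x y = c * rootProd n x (q * y) := by
    intro j hj
    have hle := h.le j hj
    have hnn := h.nonneg hj.le
    have hpos := h.pos j hj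
    have hab : x j / q ≤ x (j + 1) := by rw [div_le_iff₀ hq0]; linarith
    have hxa : x j ≤ x j / q := by rw [le_div_iff₀ hq0]; nlinarith
    have hqa : q * (x j / q) = x j := by field_simp
    set g : ℝ → ℝ := fun t => rootProd n x t - c * rootProd n x (q * t) with hg
    have hcont : Continuous g := by
      have := continuous_rootProd n x
      fun_prop
    obtain ⟨κ, hκ, hga⟩ : ∃ κ : ℝ, 0 ≤ κ ∧ g (x j / q) = κ * rootProd n x (x j / q) := by
      rcases j with _ | j
      · refine ⟨1 - c, by linarith, ?_⟩
        simp [hg, h.zero, rootProd_zero]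
      · refine ⟨1, zero_le_one, ?_⟩
        simp only [hg, hqa]
        rw [h.rootProd_self (by omega)]
        ring
    have hgb : g (x (j + 1)) = -(c * rootProd n x (q * x (j + 1))) := by
      simp only [hg]
      rw [h.rootProd_self hj]
      ring
    have hsign : g (x j / q) * g (x (j + 1)) ≤ 0 := by
      have := h.rootProd_mul_nonneg hq1 hj hxa hab hle (by nlinarith)
      have h2 := mul_nonneg (mul_nonneg hκ hc0.le) this
      rw [hga, hgb]
      linarith
    have h0 : (0 : ℝ) ∈ Set.uIcc (g (x j / q)) (g (x (j + 1))) := by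
      rw [Set.mem_uIcc]
      rcases mul_nonpos_iff.1 hsign with h' | h'
      · exact Or.inr ⟨h'.2, h'.1⟩
      · exact Or.inl h'
    obtain ⟨y, hy, hy0⟩ := intermediate_value_uIcc hcont.continuousOn h0
    rw [Set.uIcc_of_le hab] at hy
    have hroot : rootProd n x y = c * rootProd n x (q * y) := sub_eq_zero.1 hy0
    have hy1 : x j ≤ q * y := by
      have := hy.1
      rw [div_le_iff₀ hq0] at this
      linarith
    refine ⟨y, ?_, hy1, hy.2, hroot⟩
    have hy0' : 0 ≤ y := by
      by_contra! hneg
      nlinarith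
    refine lt_of_le_of_ne hy0' ?_
    rintro rfl
    rw [mul_zero, rootProd_zero] at hroot
    linarith
  choose! y hy using key
  refine ⟨fun i => if i = 0 then 0 else y (i - 1), by simp, ?_, ?_, ?_, ?_⟩ <;>
    intro i hi <;> simp [hy i hi]

end QSpaced

namespace QInterlace

variable {q : ℝ} {n : ℕ} {c d : ℝ} {x y z w : ℕ → ℝ}

lemma qSpaced (h : QInterlace q n c x y) (hx : QSpaced q n x) : QSpaced q n y where
  zero := h.zero
  pos := h.pos
  le i hi := by
    rcases i with _ | i
    · rw [h.zero, ← hx.zero]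
      exact h.lower 0 hi
    · exact (h.upper i (by omega)).trans (h.lower (i + 1) hi)

lemma le_left (h : QInterlace q n c x y) (hx : QSpaced q n x) {i : ℕ} (hi : i ≤ n) :
    y i ≤ x i := by
  rcases i with _ | i
  · rw [h.zero, hx.zero]
  · exact h.upper i hi

lemma mul_factor_bounds (hq1 : q < 1) (hx : QSpaced q n x) (hz : QSpaced q n z)
    (hxz : ∀ i ≤ n, x i ≤ z i) {j : ℕ} (hj : j < n) {l u : ℝ} (hl : 0 < l) (hlu : l ≤ u)
    (hzl : z j ≤ q * l) (hux : u ≤ x (j + 1)) {i : ℕ} (hi : i < n) :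
    0 ≤ (1 - q * l / z (i + 1)) * (1 - u / x (i + 1)) ∧
    (1 - q * l / z (i + 1)) * (1 - u / x (i + 1)) ≤
      (1 - l / z (i + 1)) * (1 - q * u / x (i + 1)) ∧
    (l < u → (1 - q * l / z (i + 1)) * (1 - u / x (i + 1)) <
      (1 - l / z (i + 1)) * (1 - q * u / x (i + 1))) := by
  have hxp := hx.pos i hi
  have hzp := hz.pos i hi
  have hxzi := hxz (i + 1) hi
  have hdiff : (1 - l / z (i + 1)) * (1 - q * u / x (i + 1)) -
      (1 - q * l / z (i + 1)) * (1 - u / x (i + 1)) =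
      (1 - q) * (u / x (i + 1) - l / z (i + 1)) := by ring
  have h1 : l / z (i + 1) ≤ l / x (i + 1) := div_le_div_of_nonneg_left hl.le hxp hxzi
  refine ⟨?_, ?_, fun hlt => ?_⟩
  · rcases lt_or_ge i j with hij | hij
    · have hzm := hz.mono hq1 (i := i + 1) (j := j) hij hj.le
      apply mul_nonneg_of_nonpos_of_nonpos
      · rw [sub_nonpos, one_le_div hzp]; linarith
      · rw [sub_nonpos, one_le_div hxp]; nlinarith
    · have hxm := hx.mono hq1 (i := j + 1) (j := i + 1) (by omega) hi
      apply mul_nonneg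
      · rw [sub_nonneg, div_le_one hzp]; nlinarith
      · rw [sub_nonneg, div_le_one hxp]; linarith
  · have h2 : l / x (i + 1) ≤ u / x (i + 1) := by gcongr
    nlinarith
  · have h2 : l / x (i + 1) < u / x (i + 1) := by gcongr
    nlinarith

lemma mono (hq1 : q < 1) (hc : 0 < c) (hdc : d ≤ c)
    (hx : QSpaced q n x) (hz : QSpaced q n z) (hxz : ∀ i ≤ n, x i ≤ z i)
    (hy : QInterlace q n c x y) (hw : QInterlace q n d z w) : ∀ i ≤ n, y i ≤ w i := by
  intro i hi
  rcases i with _ | j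
  · rw [hy.zero, hw.zero]
  by_contra! hlt
  have hj : j < n := hi
  have hb := fun i (hi : i < n) => mul_factor_bounds hq1 hx hz hxz hj (hw.pos j hj) hlt.le
    (hw.lower j hj) (hy.upper j hj) hi
  have h0 : 0 ≤ rootProd n z (q * w (j + 1)) * rootProd n x (y (j + 1)) := by
    rw [rootProd, rootProd, ← prod_mul_distrib]
    exact prod_nonneg fun i hi => (hb i (mem_range.1 hi)).1
  have h1 : rootProd n z (q * w (j + 1)) * rootProd n x (y (j + 1)) <
      rootProd n z (w (j + 1)) * rootProd n x (q * y (j + 1)) := by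
    have hpos : 0 < rootProd n z (w (j + 1)) * rootProd n x (q * y (j + 1)) := by
      rw [rootProd, rootProd, ← prod_mul_distrib]
      exact prod_pos fun i hi =>
        (hb i (mem_range.1 hi)).1.trans_lt ((hb i (mem_range.1 hi)).2.2 hlt)
    rcases h0.eq_or_lt with h' | h'
    · rwa [← h']
    · have hne := h'.ne'
      rw [rootProd, rootProd, ← prod_mul_distrib] at hne ⊢
      rw [rootProd, rootProd, ← prod_mul_distrib]
      refine prod_lt_prod_of_nonempty (fun i hi => ?_)
        (fun i hi => (hb i (mem_range.1 hi)).2.2 hlt) ⟨j, mem_range.2 hj⟩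
      exact lt_of_le_of_ne (hb i (mem_range.1 hi)).1 (prod_ne_zero_iff.1 hne i hi).symm
  rw [hy.root j hj] at h0 h1
  rw [hw.root j hj] at h1
  have h2 : 0 ≤ rootProd n z (q * w (j + 1)) * rootProd n x (q * y (j + 1)) := by
    by_contra! h'
    nlinarith
  nlinarith

lemma strict_mono (hq0 : 0 < q) (hq1 : q < 1) (hdc : d < c)
    (hx : QSpaced q n x) (hz : QSpaced q n z) (hxz : ∀ i ≤ n, x i ≤ z i)
    (hy : QInterlace q n c x y) (hw : QInterlace q n d z w) {j : ℕ} (hj : j < n) (hc : 0 < c)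
    (hlow : z j < q * w (j + 1)) : y (j + 1) < w (j + 1) := by
  by_contra! hle
  have hwp := hw.pos j hj
  have hux := hy.upper j hj
  have hb := fun i (hi : i < n) => mul_factor_bounds hq1 hx hz hxz hj hwp hle
    hlow.le hux hi
  have h0 : 0 ≤ rootProd n z (q * w (j + 1)) * rootProd n x (y (j + 1)) := by
    rw [rootProd, rootProd, ← prod_mul_distrib]
    exact prod_nonneg fun i hi => (hb i (mem_range.1 hi)).1
  have h1 : rootProd n z (q * w (j + 1)) * rootProd n x (y (j + 1)) ≤
      rootProd n z (w (j + 1)) * rootProd n x (q * y (j + 1)) := by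
    simp only [rootProd, ← prod_mul_distrib]
    exact prod_le_prod (fun i hi => (hb i (mem_range.1 hi)).1)
      (fun i hi => (hb i (mem_range.1 hi)).2.1)
  rw [hy.root j hj] at h0 h1
  rw [hw.root j hj] at h1
  have hxzj := hxz (j + 1) hj
  have hxzj' := hxz j hj.le
  have hne : rootProd n z (q * w (j + 1)) * rootProd n x (q * y (j + 1)) ≠ 0 :=
    mul_ne_zero (hz.rootProd_ne_zero hq1 hj hlow (by nlinarith))
      (hx.rootProd_ne_zero hq1 hj (by nlinarith) (by nlinarith))
  have h2 : 0 ≤ rootProd n z (q * w (j + 1)) * rootProd n x (q * y (j + 1)) := by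
    by_contra! h'
    nlinarith
  have h3 := lt_of_le_of_ne h2 hne.symm
  nlinarith

/-- A strict gap in `x` makes the lower interlacing inequality strict. -/
lemma lower_lt (hq1 : q < 1) (hx : QSpaced q n x) (hy : QInterlace q n c x y)
    {j : ℕ} (hj : j < n) (hgap : x j < q * x (j + 1)) : x j < q * y (j + 1) := by
  refine lt_of_le_of_ne (hy.lower j hj) fun heq => ?_
  have hyp := hy.pos j hj
  have hlt : y (j + 1) < x (j + 1) := by
    refine lt_of_le_of_ne (hy.upper j hj) fun h => ?_
    rw [heq, h] at hgap
    exact lt_irrefl _ hgap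
  refine hx.rootProd_ne_zero hq1 hj (by nlinarith) hlt ?_
  rw [hy.root j hj, ← heq]
  rcases j with _ | j
  · exfalso
    simp only [hx.zero, zero_add] at heq hgap hyp hlt
    nlinarith
  · rw [hx.rootProd_self (by omega), mul_zero]

/-- A strict gap in `x` makes the upper interlacing inequality strict. -/
lemma upper_lt (hq1 : q < 1) (hc : c ≠ 0) (hx : QSpaced q n x) (hy : QInterlace q n c x y)
    {j : ℕ} (hj : j < n) (hgap : x j < q * x (j + 1)) : y (j + 1) < x (j + 1) := by
  refine lt_of_le_of_ne (hy.upper j hj) fun heq => ?_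
  have hxp := hx.pos j hj
  have hroot := hy.root j hj
  rw [heq, hx.rootProd_self hj, eq_comm] at hroot
  exact hx.rootProd_ne_zero hq1 hj hgap (by nlinarith) ((mul_eq_zero.1 hroot).resolve_left hc)

end QInterlace

open Polynomial in
lemma sum_eq_rootProd {q : ℝ} (hq1 : q < 1) {n : ℕ} {x a : ℕ → ℝ} (hx : QSpaced q n x)
    (ha : a 0 = 1)
    (hroot : ∀ i < n, ∑ k ∈ range (n + 1), a k * x (i + 1) ^ k = 0) (t : ℝ) :
    ∑ k ∈ range (n + 1), a k * t ^ k = rootProd n x t := by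
  set P : ℝ[X] := ∑ k ∈ range (n + 1), C (a k) * X ^ k with hP
  set R : ℝ[X] := ∏ i ∈ range n, (1 - C (x (i + 1))⁻¹ * X) with hR
  have hPe : ∀ s, P.eval s = ∑ k ∈ range (n + 1), a k * s ^ k := by
    intro s
    simp [hP, eval_finsetSum]
  have hRe : ∀ s, R.eval s = rootProd n x s := by
    intro s
    simp only [hR, rootProd, eval_prod]
    refine prod_congr rfl fun i _ => ?_
    simp
    ring
  have hPd : P.degree < (range (n + 1)).card := by
    rw [card_range, ← mem_degreeLT]
    refine Submodule.sum_mem _ fun k hk => ?_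
    rw [mem_degreeLT]
    exact (degree_C_mul_X_pow_le k _).trans_lt (by exact_mod_cast mem_range.1 hk)
  have hRd : R.degree < (range (n + 1)).card := by
    rw [card_range]
    have h1 : R.degree ≤ ∑ i ∈ range n, (1 : WithBot ℕ) := by
      refine (degree_prod_le _ _).trans (sum_le_sum fun i _ => ?_)
      compute_degree
    refine h1.trans_lt ?_
    simp only [sum_const, card_range, nsmul_eq_mul, mul_one]
    exact_mod_cast Nat.lt_succ_self n
  have hinj : Set.InjOn x (range (n + 1)) := by
    intro i hi j hj hij
    have hi' : i ≤ n := Nat.lt_succ_iff.1 (mem_range.1 hi)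
    have hj' : j ≤ n := Nat.lt_succ_iff.1 (mem_range.1 hj)
    rcases lt_trichotomy i j with h | h | h
    · exact absurd hij (hx.lt hq1 h hj').ne
    · exact h
    · exact absurd hij (hx.lt hq1 h hi').ne'
  have hPR : P = R := by
    refine eq_of_degrees_lt_of_eval_index_eq (range (n + 1)) hinj hPd hRd fun i hi => ?_
    rw [hPe, hRe]
    rcases i with _ | i
    · rw [hx.zero, rootProd_zero, sum_range_succ']
      simp [ha]
    · have hi' : i < n := by simpa using hi
      rw [hroot i hi', hx.rootProd_self hi']
  rw [← hPe, ← hRe, hPR]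

/-- A family of polynomials joining `(q^{1-n} t; q)_n` (for `ε = α`) and the little `q`-Laguerre
polynomial (for `ε = 0`). -/
noncomputable def wallFamily (q : ℝ) (n : ℕ) (α ε t : ℝ) : ℝ :=
  ∑ k ∈ range (n + 1), qpoch q (q ^ (-(n : ℤ))) k * qpoch q (ε * q) k /
    (qpoch q (α * q) k * qpoch q q k) * (q * t) ^ k

lemma qpoch_zero (q a : ℝ) : qpoch q a 0 = 1 := by simp [qpoch]

lemma qpoch_succ (q a : ℝ) (k : ℕ) : qpoch q a (k + 1) = qpoch q a k * (1 - a * q ^ k) :=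
  prod_range_succ _ _

lemma qpoch_succ' (q a : ℝ) (k : ℕ) : qpoch q a (k + 1) = (1 - a) * qpoch q (a * q) k := by
  rw [qpoch, prod_range_succ', mul_comm, qpoch]
  congr 1
  · simp
  · refine prod_congr rfl fun i _ => ?_
    ring

lemma qpoch_pos {q a : ℝ} (hq0 : 0 < q) (hq1 : q < 1) (ha0 : 0 ≤ a) (ha1 : a < 1) (k : ℕ) :
    0 < qpoch q a k := by
  refine prod_pos fun j _ => ?_
  have h1 : q ^ j ≤ 1 := pow_le_one₀ hq0.le hq1.le
  have h2 : 0 < q ^ j := by positivity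
  nlinarith

lemma wallFamily_zero_eq (q : ℝ) (n : ℕ) (α t : ℝ) :
    wallFamily q n α 0 t = littleQLaguerrePoly q n α t := by
  simp [wallFamily, littleQLaguerrePoly, qpoch]

lemma wallFamily_at_zero (q : ℝ) (n : ℕ) (α ε : ℝ) : wallFamily q n α ε 0 = 1 := by
  rw [wallFamily, sum_range_succ']
  simp [qpoch_zero]

lemma continuous_wallFamily (q : ℝ) (n : ℕ) (α : ℝ) :
    Continuous fun p : ℝ × ℝ => wallFamily q n α p.1 p.2 := by
  unfold wallFamily qpoch
  fun_prop

lemma wallFamily_eq_rootProd {q : ℝ} (hq1 : q < 1) {n : ℕ} {x : ℕ → ℝ} (hx : QSpaced q n x)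
    {α ε : ℝ} (hroot : ∀ i < n, wallFamily q n α ε (x (i + 1)) = 0) (t : ℝ) :
    wallFamily q n α ε t = rootProd n x t := by
  have h : ∀ s, wallFamily q n α ε s = ∑ k ∈ range (n + 1),
      (qpoch q (q ^ (-(n : ℤ))) k * qpoch q (ε * q) k /
        (qpoch q (α * q) k * qpoch q q k) * q ^ k) * s ^ k := by
    intro s
    refine sum_congr rfl fun k _ => ?_
    rw [mul_pow]
    ring
  rw [h]
  refine sum_eq_rootProd hq1 hx (by simp [qpoch_zero]) (fun i hi => ?_) t
  rw [← h, hroot i hi]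

lemma wallFamily_shift {q : ℝ} (hq0 : 0 < q) (hq1 : q < 1) (n : ℕ) {α : ℝ} (hα0 : 0 < α)
    (hα1 : α * q < 1) (ε t : ℝ) :
    (1 - α * q) * wallFamily q n α ε t =
      wallFamily q n (α * q) ε t - α * q * wallFamily q n (α * q) ε (q * t) := by
  simp only [wallFamily, mul_sum, ← sum_sub_distrib]
  refine sum_congr rfl fun k _ => ?_
  have hp : 0 < α * q := by positivity
  have h1 := (qpoch_pos hq0 hq1 hp.le hα1 k).ne'
  have h2 := (qpoch_pos hq0 hq1 (a := α * q * q) (by positivity) (by nlinarith) k).ne'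
  have h3 := (qpoch_pos hq0 hq1 hq0.le hq1 k).ne'
  have h4 : qpoch q (α * q) k * (1 - α * q * q ^ k) = (1 - α * q) * qpoch q (α * q * q) k := by
    rw [← qpoch_succ, qpoch_succ']
  rw [mul_pow q (q * t), mul_pow q t]
  generalize qpoch q (α * q) k = A at *
  generalize qpoch q (α * q * q) k = B at *
  generalize qpoch q (q ^ (-(n : ℤ))) k = D
  generalize qpoch q (ε * q) k = E
  field_simp
  linear_combination (-D * E * t ^ k) * h4

/-- The zeros of `(q^{1-n} t; q)_n` in increasing order, preceded by `0`. -/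
noncomputable def geomRoots (q : ℝ) (n i : ℕ) : ℝ := if i = 0 then 0 else q ^ (n - i)

lemma geomRoots_qSpaced {q : ℝ} (hq0 : 0 < q) (n : ℕ) :
    QSpaced q n (geomRoots q n) where
  zero := by simp [geomRoots]
  pos i _ := by simp only [geomRoots, Nat.succ_ne_zero, if_false]; positivity
  le i hi := by
    rcases i with _ | i
    · simp only [geomRoots, Nat.succ_ne_zero, if_false, if_true]; positivity
    · simp only [geomRoots, Nat.succ_ne_zero, if_false]
      rw [← pow_succ']
      apply le_of_eq
      congr 1
      omega

lemma wallFamily_diag_shift {q : ℝ} (hq0 : 0 < q) (hq1 : q < 1) (n : ℕ) {α : ℝ} (hα0 : 0 < α)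
    (hα1 : α * q < 1) (t : ℝ) :
    (1 - q * t) * wallFamily q n α α t =
      (1 - q * t * q ^ (-(n : ℤ))) * wallFamily q n α α (q * t) := by
  set b : ℕ → ℝ := fun k => qpoch q (q ^ (-(n : ℤ))) k / qpoch q q k with hb
  have hw : ∀ s, wallFamily q n α α s = ∑ k ∈ range (n + 1), b k * (q * s) ^ k := by
    intro s
    refine sum_congr rfl fun k _ => ?_
    have h1 := (qpoch_pos hq0 hq1 (a := α * q) (by positivity) hα1 k).ne'
    simp only [hb]
    field_simp
  have hbs : ∀ k, b (k + 1) * (1 - q ^ (k + 1)) = b k * (1 - q ^ (-(n : ℤ)) * q ^ k) := by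
    intro k
    have h1 := (qpoch_pos hq0 hq1 hq0.le hq1 k).ne'
    have h2 := (qpoch_pos hq0 hq1 hq0.le hq1 (k + 1)).ne'
    simp only [hb, qpoch_succ] at h2 ⊢
    have h3 : 1 - q * q ^ k ≠ 0 := right_ne_zero_of_mul h2
    rw [mul_comm q] at h3 ⊢
    rw [pow_succ]
    field_simp
  have hlast : 1 - q ^ (-(n : ℤ)) * q ^ n = 0 := by
    rw [zpow_neg, zpow_natCast, inv_mul_cancel₀ (by positivity), sub_self]
  have h1 : wallFamily q n α α t - wallFamily q n α α (q * t) =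
      ∑ k ∈ range n, b k * (1 - q ^ (-(n : ℤ)) * q ^ k) * (q * t) ^ (k + 1) := by
    rw [hw, hw, ← sum_sub_distrib, sum_range_succ']
    simp only [pow_zero, sub_self, add_zero]
    refine sum_congr rfl fun k _ => ?_
    rw [← hbs, mul_pow q (q * t)]
    ring
  have h2 : q * t * (wallFamily q n α α t - q ^ (-(n : ℤ)) * wallFamily q n α α (q * t)) =
      ∑ k ∈ range n, b k * (1 - q ^ (-(n : ℤ)) * q ^ k) * (q * t) ^ (k + 1) := by
    have h3 : ∑ k ∈ range n, b k * (1 - q ^ (-(n : ℤ)) * q ^ k) * (q * t) ^ (k + 1) =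
        ∑ k ∈ range (n + 1), b k * (1 - q ^ (-(n : ℤ)) * q ^ k) * (q * t) ^ (k + 1) := by
      rw [sum_range_succ, hlast]
      ring
    rw [h3, hw, hw, mul_sum, ← sum_sub_distrib, mul_sum]
    refine sum_congr rfl fun k _ => ?_
    rw [mul_pow q (q * t)]
    ring
  linear_combination h1 - h2

lemma wallFamily_diag_root {q : ℝ} (hq0 : 0 < q) (hq1 : q < 1) {n : ℕ} {α : ℝ} (hα0 : 0 < α)
    (hα1 : α * q < 1) {m : ℕ} (hm : m < n) : wallFamily q n α α (q ^ m) = 0 := by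
  have key : ∀ s : ℝ, (1 - q * s) * wallFamily q n α α s = 0 →
      q * s * q ^ (-(n : ℤ)) ≠ 1 → wallFamily q n α α (q * s) = 0 := by
    intro s h hs
    rw [wallFamily_diag_shift hq0 hq1 n hα0 hα1] at h
    exact (mul_eq_zero.1 h).resolve_left (sub_ne_zero.2 hs.symm)
  have hne : ∀ m < n, q ^ m * q ^ (-(n : ℤ)) ≠ 1 := by
    intro m hm h
    rw [zpow_neg, zpow_natCast, mul_inv_eq_one₀ (by positivity)] at h
    exact absurd h (pow_lt_pow_right_of_lt_one₀ hq0 hq1 hm).ne'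
  induction m with
  | zero =>
    have h := key q⁻¹ (by rw [mul_inv_cancel₀ hq0.ne']; ring)
      (by rw [mul_inv_cancel₀ hq0.ne']; simpa using hne 0 hm)
    rwa [mul_inv_cancel₀ hq0.ne', ← pow_zero q] at h
  | succ m ih =>
    rw [pow_succ']
    refine key _ (by rw [ih (by omega), mul_zero]) ?_
    rw [← pow_succ']
    exact hne _ hm

/-- The zeros of `wallFamily q n α (α * q ^ J)`, preceded by `0`. -/
noncomputable def approxRoots (q : ℝ) (n : ℕ) : ℕ → ℝ → ℕ → ℝ
  | 0, _ => geomRoots q n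
  | J + 1, α => Classical.epsilon (QInterlace q n (α * q) (approxRoots q n J (α * q)))

section Approx

variable {q : ℝ} {n : ℕ}

lemma approxRoots_qSpaced_interlace (hq0 : 0 < q) (hq1 : q < 1) (J : ℕ) :
    ∀ α : ℝ, 0 < α → α * q < 1 → QSpaced q n (approxRoots q n J α) ∧
      QInterlace q n (α * q) (approxRoots q n J (α * q)) (approxRoots q n (J + 1) α) := by
  have step : ∀ J α, 0 < α → α * q < 1 → QSpaced q n (approxRoots q n J (α * q)) →
      QInterlace q n (α * q) (approxRoots q n J (α * q)) (approxRoots q n (J + 1) α) := by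
    intro J α h0 h1 h
    exact Classical.epsilon_spec (h.exists_interlace hq0 hq1 (by positivity) h1)
  induction J with
  | zero => exact fun α h0 h1 => ⟨geomRoots_qSpaced hq0 n, step 0 α h0 h1 (geomRoots_qSpaced hq0 n)⟩
  | succ J ih =>
    have hs : ∀ α : ℝ, 0 < α → α * q < 1 → QSpaced q n (approxRoots q n (J + 1) α) :=
      fun α h0 h1 => (ih α h0 h1).2.qSpaced (ih (α * q) (by positivity) (by nlinarith)).1
    exact fun α h0 h1 =>
      ⟨hs α h0 h1, step (J + 1) α h0 h1 (hs (α * q) (by positivity) (by nlinarith))⟩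

lemma approxRoots_qSpaced (hq0 : 0 < q) (hq1 : q < 1) (J : ℕ) {α : ℝ} (h0 : 0 < α)
    (h1 : α * q < 1) : QSpaced q n (approxRoots q n J α) :=
  (approxRoots_qSpaced_interlace hq0 hq1 J α h0 h1).1

lemma approxRoots_interlace (hq0 : 0 < q) (hq1 : q < 1) (J : ℕ) {α : ℝ} (h0 : 0 < α)
    (h1 : α * q < 1) :
    QInterlace q n (α * q) (approxRoots q n J (α * q)) (approxRoots q n (J + 1) α) :=
  (approxRoots_qSpaced_interlace hq0 hq1 J α h0 h1).2

lemma approxRoots_anti (hq0 : 0 < q) (hq1 : q < 1) (J : ℕ) :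
    ∀ α β : ℝ, 0 < α → α ≤ β → β * q < 1 →
      ∀ i ≤ n, approxRoots q n J β i ≤ approxRoots q n J α i := by
  induction J with
  | zero => exact fun _ _ _ _ _ _ _ => le_rfl
  | succ J ih =>
    intro α β hα hαβ hβ
    have hβ0 : 0 < β := hα.trans_le hαβ
    have hαβq : α * q ≤ β * q := by gcongr
    have hα1 : α * q < 1 := hαβq.trans_lt hβ
    exact QInterlace.mono hq1 (by positivity) hαβq
      (approxRoots_qSpaced hq0 hq1 J (by positivity) (by nlinarith))
      (approxRoots_qSpaced hq0 hq1 J (by positivity) (by nlinarith))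
      (ih _ _ (by positivity) hαβq (by nlinarith))
      (approxRoots_interlace hq0 hq1 J hβ0 hβ) (approxRoots_interlace hq0 hq1 J hα hα1)

lemma approxRoots_succ_le (hq0 : 0 < q) (hq1 : q < 1) (J : ℕ) :
    ∀ α : ℝ, 0 < α → α * q < 1 →
      ∀ i ≤ n, approxRoots q n (J + 1) α i ≤ approxRoots q n J α i := by
  induction J with
  | zero =>
    intro α h0 h1 i hi
    exact (approxRoots_interlace hq0 hq1 0 h0 h1).le_left (geomRoots_qSpaced hq0 n) hi
  | succ J ih =>
    intro α h0 h1
    have h2 : 0 < α * q := by positivity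
    have h3 : α * q * q < 1 := by nlinarith
    exact QInterlace.mono hq1 h2 le_rfl (approxRoots_qSpaced hq0 hq1 _ h2 h3)
      (approxRoots_qSpaced hq0 hq1 _ h2 h3) (ih _ h2 h3)
      (approxRoots_interlace hq0 hq1 _ h0 h1) (approxRoots_interlace hq0 hq1 _ h0 h1)

lemma wallFamily_eq_rootProd_approxRoots (hq0 : 0 < q) (hq1 : q < 1) (J : ℕ) :
    ∀ α : ℝ, 0 < α → α * q < 1 → ∀ t,
      wallFamily q n α (α * q ^ J) t = rootProd n (approxRoots q n J α) t := by
  induction J with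
  | zero =>
    intro α h0 h1
    refine wallFamily_eq_rootProd hq1 (approxRoots_qSpaced hq0 hq1 0 h0 h1) fun i hi => ?_
    rw [pow_zero, mul_one]
    exact wallFamily_diag_root hq0 hq1 h0 h1 (by omega)
  | succ J ih =>
    intro α h0 h1
    refine wallFamily_eq_rootProd hq1 (approxRoots_qSpaced hq0 hq1 _ h0 h1) fun i hi => ?_
    have hs := wallFamily_shift hq0 hq1 n h0 h1 (α * q ^ (J + 1))
      (approxRoots q n (J + 1) α (i + 1))
    have ih' := ih (α * q) (by positivity) (by nlinarith)
    rw [mul_assoc α q, ← pow_succ'] at ih'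
    rw [ih', ih', (approxRoots_interlace hq0 hq1 J h0 h1).root i hi, sub_self] at hs
    exact (mul_eq_zero.1 hs).resolve_left (by linarith)

/-- The zeros of the little `q`-Laguerre polynomial in increasing order, preceded by `0`. -/
noncomputable def wallRoots (q : ℝ) (n : ℕ) (α : ℝ) (i : ℕ) : ℝ := ⨅ J, approxRoots q n J α i

lemma tendsto_approxRoots (hq0 : 0 < q) (hq1 : q < 1) {α : ℝ} (h0 : 0 < α) (h1 : α * q < 1)
    {i : ℕ} (hi : i ≤ n) :
    Tendsto (fun J => approxRoots q n J α i) atTop (𝓝 (wallRoots q n α i)) := by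
  refine tendsto_atTop_ciInf
    (antitone_nat_of_succ_le fun J => approxRoots_succ_le hq0 hq1 J α h0 h1 i hi) ⟨0, ?_⟩
  rintro _ ⟨J, rfl⟩
  exact (approxRoots_qSpaced hq0 hq1 J h0 h1).nonneg hi

lemma wallFamily_wallRoots (hq0 : 0 < q) (hq1 : q < 1) {α : ℝ} (h0 : 0 < α) (h1 : α * q < 1)
    {i : ℕ} (hi : i < n) : wallFamily q n α 0 (wallRoots q n α (i + 1)) = 0 := by
  have hε : Tendsto (fun J : ℕ => α * q ^ J) atTop (𝓝 0) := by
    simpa using (tendsto_pow_atTop_nhds_zero_of_lt_one hq0.le hq1).const_mul α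
  have hlim := ((continuous_wallFamily q n α).tendsto (0, wallRoots q n α (i + 1))).comp
    (hε.prodMk_nhds (tendsto_approxRoots hq0 hq1 h0 h1 (i := i + 1) hi))
  refine tendsto_nhds_unique hlim (tendsto_const_nhds.congr fun J => ?_)
  simp only [Function.comp]
  rw [wallFamily_eq_rootProd_approxRoots hq0 hq1 J α h0 h1,
    (approxRoots_qSpaced hq0 hq1 J h0 h1).rootProd_self hi]

lemma wallRoots_qSpaced (hq0 : 0 < q) (hq1 : q < 1) {α : ℝ} (h0 : 0 < α) (h1 : α * q < 1) :
    QSpaced q n (wallRoots q n α) where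
  zero := by
    refine tendsto_nhds_unique (tendsto_approxRoots hq0 hq1 h0 h1 (Nat.zero_le n))
      (tendsto_const_nhds.congr fun J => ?_)
    rw [(approxRoots_qSpaced hq0 hq1 J h0 h1).zero]
  pos i hi := by
    refine lt_of_le_of_ne (ge_of_tendsto' (tendsto_approxRoots hq0 hq1 h0 h1 hi) fun J =>
      (approxRoots_qSpaced hq0 hq1 J h0 h1).nonneg hi) fun h => ?_
    have := wallFamily_wallRoots hq0 hq1 h0 h1 hi
    rw [← h, wallFamily_at_zero] at this
    exact one_ne_zero this
  le i hi := le_of_tendsto_of_tendsto' (tendsto_approxRoots hq0 hq1 h0 h1 hi.le)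
    ((tendsto_approxRoots hq0 hq1 h0 h1 (i := i + 1) hi).const_mul q) fun J =>
      (approxRoots_qSpaced hq0 hq1 J h0 h1).le i hi

lemma littleQLaguerrePoly_eq_rootProd (hq0 : 0 < q) (hq1 : q < 1) {α : ℝ} (h0 : 0 < α)
    (h1 : α * q < 1) (t : ℝ) :
    littleQLaguerrePoly q n α t = rootProd n (wallRoots q n α) t := by
  rw [← wallFamily_zero_eq]
  exact wallFamily_eq_rootProd hq1 (wallRoots_qSpaced hq0 hq1 h0 h1)
    (fun i hi => wallFamily_wallRoots hq0 hq1 h0 h1 hi) t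

lemma wallRoots_interlace (hq0 : 0 < q) (hq1 : q < 1) {α : ℝ} (h0 : 0 < α) (h1 : α * q < 1) :
    QInterlace q n (α * q) (wallRoots q n (α * q)) (wallRoots q n α) := by
  have h2 : 0 < α * q := by positivity
  have h3 : α * q * q < 1 := by nlinarith
  have hs := wallRoots_qSpaced (n := n) hq0 hq1 h0 h1
  refine ⟨hs.zero, hs.pos, fun i hi => ?_, fun i hi => ?_, fun i hi => ?_⟩
  · exact le_of_tendsto_of_tendsto' (tendsto_approxRoots hq0 hq1 h2 h3 hi.le)
      (((tendsto_approxRoots hq0 hq1 h0 h1 (i := i + 1) hi).comp (tendsto_add_atTop_nat 1)).const_mul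
        q) fun J => (approxRoots_interlace hq0 hq1 J h0 h1).lower i hi
  · exact le_of_tendsto_of_tendsto'
      ((tendsto_approxRoots hq0 hq1 h0 h1 (i := i + 1) hi).comp (tendsto_add_atTop_nat 1))
      (tendsto_approxRoots hq0 hq1 h2 h3 (i := i + 1) hi)
      fun J => (approxRoots_interlace hq0 hq1 J h0 h1).upper i hi
  · have h := wallFamily_shift hq0 hq1 n h0 h1 0 (wallRoots q n α (i + 1))
    rw [wallFamily_wallRoots hq0 hq1 h0 h1 hi, mul_zero, wallFamily_zero_eq, wallFamily_zero_eq,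
      littleQLaguerrePoly_eq_rootProd hq0 hq1 h2 h3,
      littleQLaguerrePoly_eq_rootProd hq0 hq1 h2 h3] at h
    exact sub_eq_zero.1 h.symm

lemma wallRoots_anti (hq0 : 0 < q) (hq1 : q < 1) {α β : ℝ} (hα : 0 < α) (hαβ : α ≤ β)
    (hβ : β * q < 1) {i : ℕ} (hi : i ≤ n) : wallRoots q n β i ≤ wallRoots q n α i :=
  le_of_tendsto_of_tendsto' (tendsto_approxRoots hq0 hq1 (hα.trans_le hαβ) hβ hi)
    (tendsto_approxRoots hq0 hq1 hα (by nlinarith) hi)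
    fun J => approxRoots_anti hq0 hq1 J α β hα hαβ hβ i hi

lemma wallRoots_gap (hq0 : 0 < q) (hq1 : q < 1) (i : ℕ) :
    ∀ α : ℝ, 0 < α → α * q < 1 → i < n → wallRoots q n α i < q * wallRoots q n α (i + 1) := by
  induction i with
  | zero =>
    intro α h0 h1 hi
    have hs := wallRoots_qSpaced (n := n) hq0 hq1 h0 h1
    have := hs.pos 0 hi
    rw [hs.zero]
    positivity
  | succ i ih =>
    intro α h0 h1 hi
    have h2 : 0 < α * q := by positivity
    have h3 : α * q * q < 1 := by nlinarith
    have hI := wallRoots_interlace (n := n) hq0 hq1 h0 h1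
    exact (hI.upper_lt hq1 h2.ne' (wallRoots_qSpaced hq0 hq1 h2 h3) (by omega)
      (ih _ h2 h3 (by omega))).trans_le (hI.lower _ hi)

lemma wallRoots_strictAnti (hq0 : 0 < q) (hq1 : q < 1) {α β : ℝ} (hα : 0 < α) (hαβ : α < β)
    (hβ : β * q < 1) {i : ℕ} (hi : i < n) :
    wallRoots q n β (i + 1) < wallRoots q n α (i + 1) := by
  have hβ0 : 0 < β := hα.trans hαβ
  have hαβq : α * q < β * q := by gcongr
  have hα1 : α * q < 1 := hαβq.trans hβ
  have hαq : 0 < α * q := by positivity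
  have hβq : 0 < β * q := by positivity
  have hαq1 : α * q * q < 1 := by nlinarith
  have hβq1 : β * q * q < 1 := by nlinarith
  have hsα := wallRoots_qSpaced (n := n) hq0 hq1 hαq hαq1
  have hIα := wallRoots_interlace (n := n) hq0 hq1 hα hα1
  exact QInterlace.strict_mono hq0 hq1 hαβq (wallRoots_qSpaced hq0 hq1 hβq hβq1) hsα
    (fun _ hi => wallRoots_anti hq0 hq1 hαq hαβq.le hβq1 hi)
    (wallRoots_interlace hq0 hq1 hβ0 hβ) hIα hi hβq
    (hIα.lower_lt hq1 hsα hi (wallRoots_gap hq0 hq1 i _ hαq hαq1 hi))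

end Approx

/-- zeros of little q-Laguerre/Wall polynomials: monotonicity in `α`. -/
theorem stmt_16 (q : ℝ) (hq0 : 0 < q) (hq1 : q < 1) (n : ℕ) (hn : 1 ≤ n) :
    ∃ x : ℝ → Fin n → ℝ,
      (∀ α : ℝ, 0 < α → α < q⁻¹ →
        StrictMono (x α) ∧
        (∀ j, littleQLaguerrePoly q n α (x α j) = 0) ∧
        (∀ y : ℝ, littleQLaguerrePoly q n α y = 0 → ∃ j, y = x α j)) ∧
      (∀ j, StrictAntiOn (fun α => x α j) (Set.Ioo 0 q⁻¹)) := by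
  have hlt : ∀ α : ℝ, α < q⁻¹ → α * q < 1 := fun α h => by
    rwa [← one_div, lt_div_iff₀ hq0] at h
  refine ⟨fun α j => wallRoots q n α (j + 1), fun α h0 h1 => ?_, fun j α hα β hβ hαβ => ?_⟩
  · have h1 := hlt α h1
    have hs := wallRoots_qSpaced (n := n) hq0 hq1 h0 h1
    refine ⟨fun i j hij => hs.lt hq1 (by simpa using hij) j.2, fun j => ?_, fun y hy => ?_⟩
    · rw [littleQLaguerrePoly_eq_rootProd hq0 hq1 h0 h1, hs.rootProd_self j.2]
    · rw [littleQLaguerrePoly_eq_rootProd hq0 hq1 h0 h1] at hy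
      obtain ⟨i, hi, rfl⟩ := hs.exists_of_rootProd_eq_zero hy
      exact ⟨⟨i, hi⟩, rfl⟩
  · exact wallRoots_strictAnti hq0 hq1 hα.1 hαβ (hlt β hβ.2) j.2
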